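/- Let U be a normal ultrafilter on a measurable cardinal δ. Assume that 2^δ = δ⁺ and that Ult(V,U) has the δ⁺⁺-approximation property, i.e., every set X of ordinals with the property that X ∩ a ∈ Ult(V,U) for all a ∈ Ult(V,U) with |a|^{Ult(V,U)} < δ⁺⁺ belongs to Ult(V,U). Then for every limit ordinal λ, the following are equivalent: (i) there is an unbounded subset of λ that is fresh over Ult(V,U); (ii) cof(λ) = δ⁺. -/

import Mathlib

noncomputable section

open Cardinal Set

namespace MU

/-- The type of ordinals below the initial ordinal of `δ`, serving as the underlying
set of the cardinal `δ` and indexing the ultrapower. -/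
abbrev Idx (δ : Cardinal.{0}) : Type 1 := {o : Ordinal.{0} // o < δ.ord}

/-- A filter `F` is `κ`-complete (equivalently, `<κ`-closed): it is closed under
intersections of fewer than `κ` of its members. -/
def IsCComplete (κ : Cardinal.{0}) {X : Type*} (F : Filter X) : Prop :=
  ∀ (ι : Type) (t : ι → Set X), #ι < κ → (∀ j, t j ∈ F) → (⋂ j, t j) ∈ F

/-- `U` is a normal ultrafilter on the measurable cardinal `δ`: `δ` is uncountable and
`U` is a `δ`-complete nonprincipal ultrafilter on `δ` such that every function that is
regressive on a set in `U` is constant on a set in `U`. -/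
structure IsNormalUltrafilter (δ : Cardinal.{0}) (U : Ultrafilter (Idx δ)) : Prop where
  uncountable : ℵ₀ < δ
  complete : IsCComplete δ (U : Filter (Idx δ))
  nonprincipal : ∀ i : Idx δ, ({i} : Set (Idx δ)) ∉ U
  normal : ∀ f : Idx δ → Ordinal.{0}, { i : Idx δ | f i < i.1 } ∈ U →
    ∃ c : Ordinal.{0}, { i : Idx δ | f i = c } ∈ U

variable {δ : Cardinal.{0}} {U : Ultrafilter (Idx δ)}

/-- The Łoś ordering on representatives of ordinals of the ultrapower `Ult(V,U)`. -/
def ultLT (U : Ultrafilter (Idx δ)) (f g : Idx δ → Ordinal.{0}) : Prop :=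
  { i : Idx δ | f i < g i } ∈ U

theorem ultLT_wf (hU : IsNormalUltrafilter δ U) : WellFounded (ultLT U) := by
  haveI : IsIrrefl (Idx δ → Ordinal.{0}) (ultLT U) := by
    constructor
    intro f hf
    have h : ({ i : Idx δ | f i < f i } : Set (Idx δ)) = ∅ := by ext i; simp
    rw [ultLT, h] at hf
    exact Filter.empty_notMem (U : Filter (Idx δ)) hf
  haveI : IsTrans (Idx δ → Ordinal.{0}) (ultLT U) := by
    constructor
    intro f g h hfg hgh
    have hsub : ({ i : Idx δ | f i < g i } ∩ { i : Idx δ | g i < h i } : Set (Idx δ)) ⊆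
        { i : Idx δ | f i < h i } := fun i hi => show f i < h i from lt_trans hi.1 hi.2
    exact Filter.mem_of_superset (Filter.inter_mem hfg hgh) hsub
  haveI : IsStrictOrder (Idx δ → Ordinal.{0}) (ultLT U) := ⟨⟩
  rw [RelEmbedding.wellFounded_iff_isEmpty]
  constructor
  intro g
  have hmem : ∀ n : ℕ, { i : Idx δ | g (n + 1) i < g n i } ∈ U :=
    fun n => g.map_rel_iff.2 (Nat.lt_succ_self n)
  have hint : (⋂ n : ℕ, { i : Idx δ | g (n + 1) i < g n i }) ∈ U := by
    refine hU.complete ℕ _ ?_ hmem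
    rw [Cardinal.mk_nat]
    exact hU.uncountable
  obtain ⟨i, hi⟩ := Ultrafilter.nonempty_of_mem hint
  have hdesc : ∀ n : ℕ, (fun n => g n i) (n + 1) < (fun n => g n i) n :=
    fun n => Set.mem_iInter.1 hi n
  exact (RelEmbedding.wellFounded_iff_isEmpty.1 Ordinal.lt_wf).false
    (RelEmbedding.natGT (fun n => g n i) hdesc)

/-- The ordinal represented by `f` in the transitive collapse of the ultrapower
`Ult(V,U)`, i.e. the rank of `f` in the (well-founded) Łoś ordering. -/
def ordRank (hU : IsNormalUltrafilter δ U) (f : Idx δ → Ordinal.{0}) : Ordinal.{0} :=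
  sInf { o : Ordinal.{0} | Ordinal.lift.{1} o = ((ultLT_wf hU).apply f).rank }

/-- The image of an ordinal under the ultrapower embedding `j_U : V → Ult(V,U)`. -/
def jU (hU : IsNormalUltrafilter δ U) (o : Ordinal.{0}) : Ordinal.{0} :=
  ordRank hU fun _ => o

/-- The set of ordinals that is the transitive collapse of the element of the
ultrapower `Ult(V,U)` represented by the function `f`. -/
def ultSet (hU : IsNormalUltrafilter δ U) (f : Idx δ → Set Ordinal.{0}) :
    Set Ordinal.{0} :=
  { o : Ordinal.{0} |
    ∃ g : Idx δ → Ordinal.{0}, { i : Idx δ | g i ∈ f i } ∈ U ∧ ordRank hU g = o }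

/-- A set of ordinals is (the transitive collapse of) an element of the ultrapower
`Ult(V,U)`. -/
def InUlt (hU : IsNormalUltrafilter δ U) (A : Set Ordinal.{0}) : Prop :=
  ∃ f : Idx δ → Set Ordinal.{0}, (∀ i, BddAbove (f i)) ∧ A = ultSet hU f

/-- The least upper bound of a set of ordinals. -/
def lub (A : Set Ordinal.{0}) : Ordinal.{0} :=
  sSup ((fun o => o + 1) '' A)

/-- Hamkins: a set `A` of ordinals is fresh over `Ult(V,U)` if `A ∉ Ult(V,U)` but
`A ∩ α ∈ Ult(V,U)` for every `α < lub A`. -/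
def Fresh (hU : IsNormalUltrafilter δ U) (A : Set Ordinal.{0}) : Prop :=
  ¬ InUlt hU A ∧ ∀ α < lub A, InUlt hU (A ∩ Iio α)

/-- `A` is an unbounded subset of the ordinal `l`. -/
def UnbSub (A : Set Ordinal.{0}) (l : Ordinal.{0}) : Prop :=
  A ⊆ Iio l ∧ ∀ b < l, ∃ a ∈ A, b ≤ a

/-- `A` is a closed subset of the ordinal `l`: it contains the suprema of all of its
nonempty subsets that are bounded below `l`. -/
def ClosedIn (A : Set Ordinal.{0}) (l : Ordinal.{0}) : Prop :=
  ∀ S ⊆ A, S.Nonempty → sSup S < l → sSup S ∈ A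

/-- The set of limit points of a set of ordinals. -/
def limitPts (A : Set Ordinal.{0}) : Set Ordinal.{0} :=
  { b : Ordinal.{0} | (A ∩ Iio b).Nonempty ∧ sSup (A ∩ Iio b) = b }

/-- `S` is a stationary subset of the ordinal `l`. -/
def StationaryIn (S : Set Ordinal.{0}) (l : Ordinal.{0}) : Prop :=
  S ⊆ Iio l ∧ ∀ D : Set Ordinal.{0}, ClosedIn D l → UnbSub D l → (S ∩ D).Nonempty

/-- The order type of the set of ordinals `C` is at most `o`. -/
def otpLE (C : Set Ordinal.{0}) (o : Ordinal.{0}) : Prop :=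
  ∃ g : Ordinal.{0} → Ordinal.{0}, (∀ a ∈ C, g a < o) ∧
    ∀ a ∈ C, ∀ b ∈ C, a < b → g a < g b

/-- The order type of the set of ordinals `C` is (strictly) less than `o`. -/
def otpLT (C : Set Ordinal.{0}) (o : Ordinal.{0}) : Prop :=
  ∃ o' < o, otpLE C o'

/-- `C` is a `□(Θ)`-sequence, where `Θ` is (the initial ordinal of) an uncountable
regular cardinal. -/
structure IsSquareSeq (Θ : Ordinal.{0}) (C : Ordinal.{0} → Set Ordinal.{0}) : Prop where
  closed : ∀ γ < Θ, Order.IsSuccLimit γ → ClosedIn (C γ) γ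
  unbounded : ∀ γ < Θ, Order.IsSuccLimit γ → UnbSub (C γ) γ
  coherent : ∀ γ < Θ, Order.IsSuccLimit γ → ∀ β ∈ limitPts (C γ), β < γ → C β = C γ ∩ Iio β
  nontrivial : ¬ ∃ D : Set Ordinal.{0}, ClosedIn D Θ ∧ UnbSub D Θ ∧
    ∀ γ ∈ limitPts D, γ < Θ → D ∩ Iio γ = C γ

/-- `C` is a `□_κ`-sequence: a `□(κ⁺)`-sequence all of whose clubs have order type
at most `κ`. -/
def IsSquareKappaSeq (κ : Cardinal.{0}) (C : Ordinal.{0} → Set Ordinal.{0}) : Prop :=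
  IsSquareSeq (Order.succ κ).ord C ∧
    ∀ γ < (Order.succ κ).ord, Order.IsSuccLimit γ → otpLE (C γ) κ.ord

/-- `κ` is a weakly compact cardinal: `κ` is uncountable and every coloring of the
pairs of ordinals below `κ` in fewer than `κ` colors has a homogeneous set of size `κ`. -/
def IsWeaklyCompact (κ : Cardinal.{0}) : Prop :=
  ℵ₀ < κ ∧ ∀ (ν : Type) (c : Ordinal.{0} → Ordinal.{0} → ν), #ν < κ →
    ∃ H : Set Ordinal.{0}, H ⊆ Iio κ.ord ∧ Cardinal.lift.{1} κ ≤ #H ∧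
      ∀ a ∈ H, ∀ b ∈ H, ∀ a' ∈ H, ∀ b' ∈ H, a < b → a' < b' → c a b = c a' b'

/-- `κ` is a strongly compact cardinal: every `κ`-complete filter (on any set)
extends to a `κ`-complete ultrafilter. -/
def IsStronglyCompact (κ : Cardinal.{0}) : Prop :=
  ∀ (X : Type) (F : Filter X), IsCComplete κ F →
    ∃ G : Ultrafilter X, F ≤ (G : Filter X) ∧ IsCComplete κ (G : Filter X)

/-- `κ` is a singular cardinal. -/
def IsSingular (κ : Cardinal.{0}) : Prop :=
  ℵ₀ ≤ κ ∧ κ.ord.cof < κ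

/-- The cofinality of the ordinal `l` as computed inside the ultrapower `Ult(V,U)`
(as an ordinal, i.e. the image of the ultrapower's cofinality under the transitive
collapse). -/
def cofUlt (hU : IsNormalUltrafilter δ U) (l : Ordinal.{0}) : Ordinal.{0} :=
  sInf { c : Ordinal.{0} | ∃ f : Idx δ → Ordinal.{0},
    ordRank hU f = l ∧ ordRank hU (fun i => ((f i).cof).ord) = c }

/-- The ordinal `o` is (the transitive collapse of) a cardinal of the ultrapower
`Ult(V,U)`. -/
def CardInUlt (hU : IsNormalUltrafilter δ U) (o : Ordinal.{0}) : Prop :=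
  ∃ f : Idx δ → Ordinal.{0}, ordRank hU f = o ∧
    { i : Idx δ | ((f i).card).ord = f i } ∈ U

/-- The ordinal `o` is (the transitive collapse of) a regular cardinal of the
ultrapower `Ult(V,U)`. -/
def RegularInUlt (hU : IsNormalUltrafilter δ U) (o : Ordinal.{0}) : Prop :=
  ∃ f : Idx δ → Ordinal.{0}, ordRank hU f = o ∧
    { i : Idx δ | ((f i).card).IsRegular ∧ ((f i).card).ord = f i } ∈ U

/-- The cardinal successor of the ordinal `o` as computed inside the ultrapower
`Ult(V,U)`: the least ordinal above `o` that is a cardinal in `Ult(V,U)`. -/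
def succInUlt (hU : IsNormalUltrafilter δ U) (o : Ordinal.{0}) : Ordinal.{0} :=
  sInf { c : Ordinal.{0} | o < c ∧ CardInUlt hU c }

/-- The cardinality of a set of ordinals, as an (initial) ordinal: the least ordinal
`o` such that `s` is the image of a function defined on the ordinals below `o`. -/
def setCardOrd (s : Set Ordinal.{0}) : Ordinal.{0} :=
  sInf { o : Ordinal.{0} | ∃ g : Ordinal.{0} → Ordinal.{0}, s ⊆ g '' Iio o }

theorem exists_lift_eq_rank (hU : IsNormalUltrafilter δ U) (f : Idx δ → Ordinal.{0}) :
    ∃ o : Ordinal.{0}, Ordinal.lift.{1} o = ((ultLT_wf hU).apply f).rank := by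
  induction f using (ultLT_wf hU).induction with
  | _ f ih =>
  choose! r hr using ih
  let m : (∀ i, Iic (f i)) → Ordinal.{0} := fun p => r (fun i => p i)
  have hsmall : Small.{0} (Idx δ) := inferInstanceAs (Small.{0} (Iio δ.ord))
  obtain ⟨c, hc⟩ : BddAbove (range m) := Ordinal.bddAbove_of_small
  have hle : ((ultLT_wf hU).apply f).rank ≤ Ordinal.lift.{1} (c + 1) := by
    rw [Acc.rank_eq]
    refine Ordinal.iSup_le fun ⟨b, hb⟩ => ?_
    have hmin : ((ultLT_wf hU).apply b).rank ≤
        ((ultLT_wf hU).apply (fun i => min (b i) (f i))).rank := by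
      rw [Acc.rank_eq ((ultLT_wf hU).apply b)]
      refine Ordinal.iSup_le fun ⟨d, hd⟩ => Order.succ_le_of_lt ?_
      refine Acc.rank_lt_of_rel ((ultLT_wf hU).apply _) ?_
      filter_upwards [hb, hd] with i hi hi'
      exact lt_min hi' (lt_trans hi' hi)
    have hbf : ultLT U (fun i => min (b i) (f i)) f := by
      filter_upwards [hb] with i hi using min_lt_of_left_lt hi
    have hrm : r (fun i => min (b i) (f i)) ≤ c :=
      hc ⟨fun i => ⟨min (b i) (f i), mem_Iic.2 (min_le_right _ _)⟩, rfl⟩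
    refine Order.succ_le_of_lt (hmin.trans_lt ?_)
    rw [← hr _ hbf, Ordinal.lift_lt]
    exact lt_of_le_of_lt hrm (Order.lt_add_one_iff.2 le_rfl)
  obtain ⟨o, ho⟩ := Ordinal.mem_range_lift_of_le hle
  exact ⟨o, ho⟩

theorem lift_ordRank (hU : IsNormalUltrafilter δ U) (f : Idx δ → Ordinal.{0}) :
    Ordinal.lift.{1} (ordRank hU f) = ((ultLT_wf hU).apply f).rank :=
  csInf_mem (s := { o : Ordinal.{0} | Ordinal.lift.{1} o = ((ultLT_wf hU).apply f).rank })
    (exists_lift_eq_rank hU f)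

theorem ordRank_lt_of_ultLT (hU : IsNormalUltrafilter δ U) {f g : Idx δ → Ordinal.{0}}
    (h : ultLT U f g) : ordRank hU f < ordRank hU g := by
  rw [← Ordinal.lift_lt.{1}, lift_ordRank, lift_ordRank]
  exact Acc.rank_lt_of_rel ((ultLT_wf hU).apply g) h

theorem ordRank_le_of_eventually_eq (hU : IsNormalUltrafilter δ U) {f g : Idx δ → Ordinal.{0}}
    (h : ∀ᶠ i in U, f i = g i) : ordRank hU f ≤ ordRank hU g := by
  rw [← Ordinal.lift_le.{1}, lift_ordRank, lift_ordRank, Acc.rank_eq]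
  refine Ordinal.iSup_le fun ⟨d, hd⟩ => Order.succ_le_of_lt ?_
  refine Acc.rank_lt_of_rel ((ultLT_wf hU).apply _) ?_
  filter_upwards [h, hd] with i hi hi'
  exact hi ▸ hi'

theorem ordRank_congr (hU : IsNormalUltrafilter δ U) {f g : Idx δ → Ordinal.{0}}
    (h : ∀ᶠ i in U, f i = g i) : ordRank hU f = ordRank hU g :=
  (ordRank_le_of_eventually_eq hU h).antisymm
    (ordRank_le_of_eventually_eq hU (h.mono fun _ => Eq.symm))

theorem eventually_trichotomy (U : Ultrafilter (Idx δ)) (f g : Idx δ → Ordinal.{0}) :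
    (∀ᶠ i in U, f i < g i) ∨ (∀ᶠ i in U, f i = g i) ∨ ∀ᶠ i in U, g i < f i := by
  rw [← Ultrafilter.eventually_or, ← Ultrafilter.eventually_or]
  exact Filter.Eventually.of_forall fun i => lt_trichotomy _ _

theorem ordRank_lt_iff (hU : IsNormalUltrafilter δ U) {f g : Idx δ → Ordinal.{0}} :
    ordRank hU f < ordRank hU g ↔ ∀ᶠ i in U, f i < g i := by
  refine ⟨fun h => ?_, fun h => ordRank_lt_of_ultLT hU h⟩
  rcases eventually_trichotomy U f g with h' | h' | h'
  · exact h'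
  · exact absurd h (ordRank_congr hU h').not_lt
  · exact absurd h (ordRank_lt_of_ultLT hU h').not_gt

theorem ordRank_eq_iff (hU : IsNormalUltrafilter δ U) {f g : Idx δ → Ordinal.{0}} :
    ordRank hU f = ordRank hU g ↔ ∀ᶠ i in U, f i = g i := by
  refine ⟨fun h => ?_, ordRank_congr hU⟩
  rcases eventually_trichotomy U f g with h' | h' | h'
  · exact absurd h (ordRank_lt_of_ultLT hU h').ne
  · exact h'
  · exact absurd h (ordRank_lt_of_ultLT hU h').ne'

theorem le_jU (hU : IsNormalUltrafilter δ U) (o : Ordinal.{0}) : o ≤ jU hU o := by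
  induction o using WellFoundedLT.induction with
  | _ o ih =>
  refine le_of_forall_lt fun c hc => (ih c hc).trans_lt ?_
  exact (ordRank_lt_iff hU).2 (Filter.Eventually.of_forall fun _ => hc)

theorem exists_ordRank_eq (hU : IsNormalUltrafilter δ U) (o : Ordinal.{0}) :
    ∃ f, ordRank hU f = o := by
  have h : Ordinal.lift.{1} o ≤ ((ultLT_wf hU).apply fun _ => o).rank := by
    rw [← lift_ordRank, Ordinal.lift_le]
    exact le_jU hU o
  obtain ⟨f, hf, hfo⟩ := Acc.mem_range_rank_of_le _ h
  exact ⟨f, by rw [← Ordinal.lift_inj.{1}, lift_ordRank, ← hfo]⟩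

theorem ordRank_mem_ultSet (hU : IsNormalUltrafilter δ U) {g : Idx δ → Ordinal.{0}}
    {f : Idx δ → Set Ordinal.{0}} : ordRank hU g ∈ ultSet hU f ↔ ∀ᶠ i in U, g i ∈ f i := by
  refine ⟨?_, fun h => ⟨g, h, rfl⟩⟩
  rintro ⟨g', hg', h⟩
  filter_upwards [hg', (ordRank_eq_iff hU).1 h] with i hi hi'
  exact hi' ▸ hi

theorem ultSet_inter (hU : IsNormalUltrafilter δ U) (f g : Idx δ → Set Ordinal.{0}) :
    ultSet hU (fun i => f i ∩ g i) = ultSet hU f ∩ ultSet hU g := by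
  ext o
  obtain ⟨h, rfl⟩ := exists_ordRank_eq hU o
  simp only [mem_inter_iff, ordRank_mem_ultSet, Filter.eventually_and]

theorem ultSet_diff (hU : IsNormalUltrafilter δ U) (f g : Idx δ → Set Ordinal.{0}) :
    ultSet hU (fun i => f i \ g i) = ultSet hU f \ ultSet hU g := by
  ext o
  obtain ⟨h, rfl⟩ := exists_ordRank_eq hU o
  simp only [mem_sdiff, ordRank_mem_ultSet, Filter.eventually_and, Ultrafilter.eventually_not]

theorem ultSet_congr (hU : IsNormalUltrafilter δ U) {f g : Idx δ → Set Ordinal.{0}}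
    (h : ∀ᶠ i in U, f i = g i) : ultSet hU f = ultSet hU g := by
  ext o
  obtain ⟨k, rfl⟩ := exists_ordRank_eq hU o
  simp only [ordRank_mem_ultSet]
  exact Filter.eventually_congr (h.mono fun i hi => by rw [hi])

theorem InUlt.inter {hU : IsNormalUltrafilter δ U} {A B : Set Ordinal.{0}}
    (hA : InUlt hU A) (hB : InUlt hU B) : InUlt hU (A ∩ B) := by
  obtain ⟨f, hf, rfl⟩ := hA
  obtain ⟨g, -, rfl⟩ := hB
  exact ⟨fun i => f i ∩ g i, fun i => (hf i).mono inter_subset_left, (ultSet_inter hU f g).symm⟩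

theorem InUlt.diff {hU : IsNormalUltrafilter δ U} {A B : Set Ordinal.{0}}
    (hA : InUlt hU A) (hB : InUlt hU B) : InUlt hU (A \ B) := by
  obtain ⟨f, hf, rfl⟩ := hA
  obtain ⟨g, -, rfl⟩ := hB
  exact ⟨fun i => f i \ g i, fun i => (hf i).mono sdiff_subset, (ultSet_diff hU f g).symm⟩

theorem eventually_ne (hU : IsNormalUltrafilter δ U) (o : Ordinal.{0}) :
    ∀ᶠ i : Idx δ in U, i.1 ≠ o := by
  by_cases ho : o < δ.ord
  · have h := Ultrafilter.compl_mem_iff_notMem.2 (hU.nonprincipal ⟨o, ho⟩)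
    filter_upwards [h] with i hi hio
    exact hi (Subtype.ext hio)
  · exact Filter.Eventually.of_forall fun i hi => ho (hi ▸ i.2)

theorem eventually_gt (hU : IsNormalUltrafilter δ U) (x : Idx δ) :
    ∀ᶠ i : Idx δ in U, x < i := by
  have hlt : x.1 + 1 < δ.ord :=
    (isSuccLimit_ord hU.uncountable.le).add_one_lt x.2
  have h := hU.complete (x.1 + 1).ToType
    (fun t => {i | i.1 ≠ (Ordinal.ToType.mk.symm t).1})
    (by rw [mk_toType]; exact lt_ord.1 hlt) (fun t => eventually_ne hU _)
  filter_upwards [h] with i hi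
  by_contra hix
  have hix' : i.1 < x.1 + 1 := Order.lt_add_one_iff.2 (not_lt.1 hix)
  refine mem_iInter.1 hi (Ordinal.ToType.mk ⟨i.1, hix'⟩) ?_
  simp

theorem ultSet_iUnion_lt (hU : IsNormalUltrafilter δ U) (F : Idx δ → Idx δ → Set Ordinal.{0}) :
    ultSet hU (fun i => ⋃ x ∈ Iio i, F x i) = ⋃ x, ultSet hU (F x) := by
  ext o
  obtain ⟨g, rfl⟩ := exists_ordRank_eq hU o
  simp only [mem_iUnion, ordRank_mem_ultSet, mem_Iio, exists_prop]
  constructor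
  · intro h
    have : ∀ i, ∃ c : Ordinal.{0}, (∃ x, x < i ∧ g i ∈ F x i) →
        ∃ x, x < i ∧ g i ∈ F x i ∧ x.1 = c := by
      intro i
      by_cases hi : ∃ x, x < i ∧ g i ∈ F x i
      · obtain ⟨x, hx, hgx⟩ := hi
        exact ⟨x.1, fun _ => ⟨x, hx, hgx, rfl⟩⟩
      · exact ⟨0, fun h => absurd h hi⟩
    choose c hc using this
    obtain ⟨d, hd⟩ := hU.normal c (by
      filter_upwards [h] with i hi
      obtain ⟨x, hx, -, hxc⟩ := hc i hi
      exact hxc ▸ hx)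
    have hd' : ∀ᶠ i in U, c i = d := hd
    obtain ⟨j, hj, hjd⟩ := (h.and hd').exists
    obtain ⟨x, -, -, hxc⟩ := hc j hj
    refine ⟨x, ?_⟩
    filter_upwards [h, hd'] with i hi hid
    obtain ⟨y, -, hgy, hyc⟩ := hc i hi
    have : y = x := Subtype.ext (by rw [hyc, hxc, hid, hjd])
    exact this ▸ hgy
  · rintro ⟨x, hx⟩
    filter_upwards [hx, eventually_gt hU x] with i hi hxi
    exact ⟨x, hxi, hi⟩

theorem inUlt_iUnion (hU : IsNormalUltrafilter δ U) {A : Idx δ → Set Ordinal.{0}}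
    (hA : ∀ x, InUlt hU (A x)) : InUlt hU (⋃ x, A x) := by
  choose F hF hAF using hA
  refine ⟨fun i => ⋃ x ∈ Iio i, F x i, fun i => ?_, ?_⟩
  · have hsmall : Small.{0} (Idx δ) := inferInstanceAs (Small.{0} (Iio δ.ord))
    have : ∀ x, Small.{0} (F x i) := fun x => Ordinal.bddAbove_iff_small.1 (hF x i)
    have h : BddAbove (⋃ x, F x i) := Ordinal.bddAbove_of_small
    exact h.mono (iUnion₂_subset fun x _ => subset_iUnion (fun x => F x i) x)
  · rw [ultSet_iUnion_lt]
    exact iUnion_congr hAF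

theorem inUlt_of_subsingleton (hU : IsNormalUltrafilter δ U) {A : Set Ordinal.{0}}
    (hA : A.Subsingleton) : InUlt hU A := by
  rcases hA.eq_empty_or_singleton with rfl | ⟨a, rfl⟩
  · refine ⟨fun _ => ∅, fun _ => bddAbove_empty, ?_⟩
    ext o
    obtain ⟨g, rfl⟩ := exists_ordRank_eq hU o
    simp [ordRank_mem_ultSet, U.neBot.ne]
  · obtain ⟨f, rfl⟩ := exists_ordRank_eq hU a
    refine ⟨fun i => {f i}, fun _ => bddAbove_singleton, ?_⟩
    ext o
    obtain ⟨g, rfl⟩ := exists_ordRank_eq hU o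
    simp [ordRank_mem_ultSet, ordRank_eq_iff]

theorem mk_idx (δ : Cardinal.{0}) : #(Idx δ) = Cardinal.lift.{1} δ :=
  (Cardinal.mk_Iio_ordinal δ.ord).trans (by rw [card_ord])

theorem inUlt_of_mk_le (hU : IsNormalUltrafilter δ U) {A : Set Ordinal.{0}}
    (hA : #A ≤ Cardinal.lift.{1} δ) : InUlt hU A := by
  rw [← mk_idx, le_def] at hA
  obtain ⟨e⟩ := hA
  have h : A = ⋃ x, {a | ∃ h : a ∈ A, e ⟨a, h⟩ = x} := by
    ext a
    simp only [mem_iUnion, mem_ofPred_eq]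
    exact ⟨fun h => ⟨_, h, rfl⟩, fun ⟨_, h, _⟩ => h⟩
  rw [h]
  refine inUlt_iUnion hU fun x => inUlt_of_subsingleton hU ?_
  rintro a ⟨ha, hax⟩ b ⟨hb, hbx⟩
  exact congrArg Subtype.val (e.injective (hax.trans hbx.symm))

theorem exists_le_mk_inter_Iio {S : Set Ordinal.{0}} {κ : Cardinal.{1}} (h : κ < #S) :
    ∃ a ∈ S, κ ≤ #(S ∩ Iio a : Set Ordinal.{0}) := by
  by_contra! hcon
  have hle : Ordinal.type (α := S) (· < ·) ≤ κ.ord := by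
    refine le_of_forall_lt fun o ho => ?_
    obtain ⟨x, rfl⟩ := Ordinal.typein_surj _ ho
    rw [lt_ord, Ordinal.card_typein]
    refine lt_of_le_of_lt ?_ (hcon x.1 x.2)
    exact mk_le_of_injective
      (f := fun y : {y : S // y < x} => (⟨y.1.1, y.1.2, y.2⟩ : (S ∩ Iio x.1 : Set Ordinal.{0})))
      fun y z hyz => Subtype.ext (Subtype.ext (Subtype.mk.inj hyz))
  have hcard := Ordinal.card_le_card hle
  rw [Ordinal.card_type, card_ord] at hcard
  exact hcard.not_gt h

theorem mk_Iio_subtype_le {p : Ordinal.{0} → Prop} (x : Subtype p) :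
    #(Iio x) ≤ Cardinal.lift.{1} x.1.card := by
  rw [← Cardinal.mk_Iio_ordinal]
  exact mk_le_of_injective (f := fun y : Iio x => (⟨y.1.1, y.2⟩ : Iio x.1))
    fun y z hyz => Subtype.ext (Subtype.ext (Subtype.mk.inj hyz))

theorem eventually_mk_le (hU : IsNormalUltrafilter δ U) {F : Idx δ → Set Ordinal.{0}}
    (hF : ∀ a ∈ ultSet hU F, #(ultSet hU F ∩ Iio a : Set Ordinal.{0}) ≤ Cardinal.lift.{1} δ) :
    ∀ᶠ i in U, #(F i) ≤ Cardinal.lift.{1} δ := by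
  by_contra hcon
  rw [← Ultrafilter.eventually_not] at hcon
  have hpick : ∀ i, ∃ a, ¬ #(F i) ≤ Cardinal.lift.{1} δ →
      a ∈ F i ∧ Cardinal.lift.{1} δ ≤ #(F i ∩ Iio a : Set Ordinal.{0}) := by
    intro i
    by_cases hi : #(F i) ≤ Cardinal.lift.{1} δ
    · exact ⟨0, fun h => absurd hi h⟩
    · obtain ⟨a, ha⟩ := exists_le_mk_inter_Iio (not_le.1 hi)
      exact ⟨a, fun _ => ha⟩
  choose h hh using hpick
  have hle := hF (ordRank hU h)
    ((ordRank_mem_ultSet hU).2 (hcon.mono fun i hi => (hh i hi).1))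
  rw [← mk_idx, le_def] at hle
  obtain ⟨e⟩ := hle
  have hG : ∀ x : Idx δ, ∃ g : Idx δ → Ordinal.{0}, ∀ o, e o = x → ordRank hU g = o.1 := by
    intro x
    by_cases hx : ∃ o, e o = x
    · obtain ⟨o, rfl⟩ := hx
      obtain ⟨g, hg⟩ := exists_ordRank_eq hU o.1
      exact ⟨g, fun o' ho' => by rw [hg, e.injective ho']⟩
    · exact ⟨0, fun o ho => absurd ⟨o, ho⟩ hx⟩
  choose G hG using hG
  have hnew : ∀ i, ∃ y, ¬ #(F i) ≤ Cardinal.lift.{1} δ →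
      y ∈ F i ∩ Iio (h i) ∧ ∀ x < i, G x i ≠ y := by
    intro i
    by_cases hi : #(F i) ≤ Cardinal.lift.{1} δ
    · exact ⟨0, fun h => absurd hi h⟩
    · have hlt : #((fun x => G x i) '' Iio i) < #(F i ∩ Iio (h i) : Set Ordinal.{0}) := by
        refine lt_of_lt_of_le ?_ (hh i hi).2
        refine mk_image_le.trans_lt ?_
        refine (mk_Iio_subtype_le i).trans_lt ?_
        rw [Cardinal.lift_lt]
        exact lt_ord.1 i.2
      obtain ⟨y, hy, hyn⟩ := Set.not_subset.1 fun hs => (mk_le_mk_of_subset hs).not_gt hlt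
      exact ⟨y, fun _ => ⟨hy, fun x hx hxy => hyn ⟨x, hx, hxy⟩⟩⟩
  choose g hg using hnew
  have hmem : ordRank hU g ∈ ultSet hU F ∩ Iio (ordRank hU h) :=
    ⟨(ordRank_mem_ultSet hU).2 (hcon.mono fun i hi => (hg i hi).1.1),
      (ordRank_lt_iff hU).2 (hcon.mono fun i hi => (hg i hi).1.2)⟩
  have heq := (ordRank_eq_iff hU).1 (hG _ ⟨_, hmem⟩ rfl)
  obtain ⟨i, hi, hie, hix⟩ := (hcon.and (heq.and (eventually_gt hU _))).exists
  exact (hg i hi).2 _ hix hie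

theorem mk_inUlt_subsets_le (hU : IsNormalUltrafilter δ U) {F : Idx δ → Set Ordinal.{0}}
    (hF : ∀ᶠ i in U, #(F i) ≤ Cardinal.lift.{1} δ) :
    #{B : Set Ordinal.{0} | B ⊆ ultSet hU F ∧ InUlt hU B} ≤ 2 ^ Cardinal.lift.{1} δ := by
  classical
  let F' : Idx δ → Set Ordinal.{0} := fun i => if #(F i) ≤ Cardinal.lift.{1} δ then F i else ∅
  have hFF' : ∀ᶠ i in U, F' i = F i := hF.mono fun i hi => if_pos hi
  have hF' : ∀ i, #(F' i) ≤ Cardinal.lift.{1} δ := by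
    intro i
    by_cases hi : #(F i) ≤ Cardinal.lift.{1} δ <;> simp [F', hi]
  have hsub : {B : Set Ordinal.{0} | B ⊆ ultSet hU F ∧ InUlt hU B} ⊆
      range fun p : ∀ i, Set (F' i) => ultSet hU fun i => Subtype.val '' p i := by
    rintro B ⟨hBF, f, -, rfl⟩
    refine ⟨fun i => Subtype.val ⁻¹' f i, ?_⟩
    simp only [Subtype.image_preimage_coe]
    rw [ultSet_inter, ultSet_congr hU hFF', inter_eq_right.2 hBF]
  have hδ : ℵ₀ ≤ Cardinal.lift.{1} δ := by simpa using hU.uncountable.le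
  calc _ ≤ #(∀ i, Set (F' i)) := (mk_le_mk_of_subset hsub).trans mk_range_le
    _ = Cardinal.prod fun i => 2 ^ #(F' i) := by simp [mk_pi]
    _ ≤ Cardinal.prod fun _ : Idx δ => 2 ^ Cardinal.lift.{1} δ :=
      prod_le_prod _ _ fun i => power_le_power_left two_ne_zero (hF' i)
    _ = 2 ^ Cardinal.lift.{1} δ := by
      rw [prod_const', mk_idx, ← power_mul, mul_eq_self hδ]

theorem UnbSub.lt_lub {A : Set Ordinal.{0}} {l α : Ordinal.{0}} (hA : UnbSub A l) (hα : α < l) :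
    α < lub A := by
  obtain ⟨a, ha, hαa⟩ := hA.2 α hα
  have hbdd : BddAbove ((fun o => o + 1) '' A) := by
    refine ⟨l, ?_⟩
    rintro _ ⟨b, hb, rfl⟩
    exact Order.add_one_le_of_lt (hA.1 hb)
  exact (Order.lt_add_one_iff.2 hαa).trans_le (le_csSup hbdd ⟨a, ha, rfl⟩)

theorem UnbSub.lub_le {A : Set Ordinal.{0}} {l : Ordinal.{0}} (hA : UnbSub A l) : lub A ≤ l := by
  refine csSup_le' ?_
  rintro _ ⟨b, hb, rfl⟩
  exact Order.add_one_le_of_lt (hA.1 hb)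

theorem not_fresh_of_cof_le (hU : IsNormalUltrafilter δ U) {l : Ordinal.{0}}
    (hl : Order.IsSuccLimit l) (hcof : l.cof ≤ δ) {A : Set Ordinal.{0}} (hA : UnbSub A l) :
    ¬ Fresh hU A := by
  rintro ⟨hAn, hAfr⟩
  obtain ⟨f, hf⟩ := Ordinal.exists_isFundamentalSeq (o := l) rfl
  refine hAn ?_
  have hfl : ∀ x : Idx δ, ∃ α < l, ∀ h : x.1 < l.cof.ord, α = (f ⟨x.1, h⟩).1 := by
    intro x
    by_cases hx : x.1 < l.cof.ord
    · exact ⟨_, (f ⟨x.1, hx⟩).2, fun _ => rfl⟩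
    · exact ⟨0, hl.bot_lt, fun h => absurd h hx⟩
  choose α hαl hα using hfl
  have h : A = ⋃ x, A ∩ Iio (α x) := by
    rw [← inter_iUnion, eq_comm, inter_eq_left]
    intro a ha
    obtain ⟨_, ⟨x, rfl⟩, hx⟩ := hf.isCofinal_range ⟨a + 1, hl.add_one_lt (hA.1 ha)⟩
    refine mem_iUnion.2 ⟨⟨x.1, lt_of_lt_of_le x.2 (ord_le_ord.2 hcof)⟩, ?_⟩
    rw [mem_Iio, hα _ x.2]
    exact (Order.lt_add_one_iff.2 le_rfl).trans_le hx
  rw [h]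
  exact inUlt_iUnion hU fun x => hAfr _ (hA.lt_lub (hαl x))

theorem exists_subset_image_setCardOrd {S : Set Ordinal.{0}} (hS : BddAbove S) :
    ∃ g : Ordinal.{0} → Ordinal.{0}, S ⊆ g '' Iio (setCardOrd S) := by
  obtain ⟨b, hb⟩ := hS
  exact csInf_mem (s := {o | ∃ g : Ordinal.{0} → Ordinal.{0}, S ⊆ g '' Iio o})
    ⟨b + 1, id, fun a ha => ⟨a, Order.lt_add_one_iff.2 (hb ha), rfl⟩⟩

theorem mk_ultSet_le (hU : IsNormalUltrafilter δ U) {f : Idx δ → Set Ordinal.{0}}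
    (hf : ∀ i, BddAbove (f i)) :
    #(ultSet hU f) ≤ Cardinal.lift.{1} (ordRank hU fun i => setCardOrd (f i)).card := by
  choose g hg using fun i => exists_subset_image_setCardOrd (hf i)
  choose R hR using exists_ordRank_eq hU
  rw [← Cardinal.mk_Iio_ordinal]
  refine (mk_le_mk_of_subset (t := (fun o => ordRank hU fun i => g i (R o i)) '' Iio _) ?_).trans
    mk_image_le
  rintro _ ⟨k, hk, rfl⟩
  have hpre : ∀ i, ∃ y, k i ∈ f i → y < setCardOrd (f i) ∧ g i y = k i := by
    intro i
    by_cases hi : k i ∈ f i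
    · obtain ⟨y, hy⟩ := hg i hi
      exact ⟨y, fun _ => hy⟩
    · exact ⟨0, fun h => absurd h hi⟩
  choose y hy using hpre
  refine ⟨ordRank hU y, (ordRank_lt_iff hU).2 ?_, ordRank_congr hU ?_⟩
  · filter_upwards [hk] with i hi using (hy i hi).1
  · filter_upwards [hk, (ordRank_eq_iff hU).1 (hR (ordRank hU y))] with i hi hi'
    rw [hi', (hy i hi).2]

theorem inUlt_inter_ultSet (hU : IsNormalUltrafilter δ U) {l : Ordinal.{0}}
    {A : Set Ordinal.{0}} (hA : UnbSub A l) (hfr : ∀ α < lub A, InUlt hU (A ∩ Iio α))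
    {f : Idx δ → Set Ordinal.{0}} (hf : ∀ i, BddAbove (f i))
    (hcard : #(ultSet hU f) < Cardinal.lift.{1} l.cof) : InUlt hU (A ∩ ultSet hU f) := by
  have hlt : sSup ((· + 1) '' (A ∩ ultSet hU f)) < l := by
    refine Ordinal.sSup_add_one_lt_of_lt_cof ?_ fun i hi => hA.1 hi.1
    rw [← Ordinal.lift_cof]
    exact (mk_le_mk_of_subset inter_subset_right).trans_lt hcard
  have heq : A ∩ ultSet hU f = A ∩ Iio (sSup ((· + 1) '' (A ∩ ultSet hU f))) ∩ ultSet hU f := by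
    refine Subset.antisymm (fun a ha => ⟨⟨ha.1, ?_⟩, ha.2⟩) fun a ha => ⟨ha.1.1, ha.2⟩
    have hbdd : BddAbove ((· + 1) '' (A ∩ ultSet hU f)) := by
      refine ⟨l, ?_⟩
      rintro _ ⟨b, hb, rfl⟩
      exact Order.add_one_le_of_lt (hA.1 hb.1)
    exact (Order.lt_add_one_iff.2 le_rfl).trans_le (le_csSup hbdd ⟨a, ha, rfl⟩)
  rw [heq]
  exact (hfr _ (hA.lt_lub hlt)).inter ⟨f, hf, rfl⟩

theorem exists_unbSub_mk_inter_Iio_le {l : Ordinal.{0}} (hcof : l.cof = Order.succ δ) :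
    ∃ A, UnbSub A l ∧ #A = Cardinal.lift.{1} (Order.succ δ) ∧
      ∀ α < l, #(A ∩ Iio α : Set Ordinal.{0}) ≤ Cardinal.lift.{1} δ := by
  obtain ⟨f, hf⟩ := Ordinal.exists_isFundamentalSeq (o := l) rfl
  have hinj : Function.Injective fun x => (f x).1 :=
    Subtype.val_injective.comp hf.strictMono.injective
  refine ⟨range fun x => (f x).1, ⟨?_, fun b hb => ?_⟩, ?_, fun α hα => ?_⟩
  · rintro _ ⟨x, rfl⟩
    exact (f x).2
  · obtain ⟨_, ⟨x, rfl⟩, hx⟩ := hf.isCofinal_range ⟨b, hb⟩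
    exact ⟨_, ⟨x, rfl⟩, hx⟩
  · rw [mk_range_eq _ hinj, Cardinal.mk_Iio_ordinal, card_ord, hcof]
  · obtain ⟨_, ⟨x, rfl⟩, hx⟩ := hf.isCofinal_range ⟨α, hα⟩
    have hsub : (range fun x => (f x).1) ∩ Iio α ⊆ (fun x => (f x).1) '' Iio x := by
      rintro _ ⟨⟨y, rfl⟩, hy⟩
      exact ⟨y, hf.strictMono.lt_iff_lt.1 (lt_of_lt_of_le hy hx), rfl⟩
    refine (mk_le_mk_of_subset hsub).trans (mk_image_le.trans ?_)
    refine (mk_Iio_subtype_le x).trans ?_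
    rw [Cardinal.lift_le, ← Order.lt_succ_iff, ← hcof]
    exact lt_ord.1 x.2

theorem inUlt_of_subset_of_forall_unbSub (hU : IsNormalUltrafilter δ U) {l : Ordinal.{0}}
    {A B : Set Ordinal.{0}} (hA : UnbSub A l) (hBA : B ⊆ A)
    (h : ∀ C ⊆ A, UnbSub C l → InUlt hU C) : InUlt hU B := by
  by_cases hB : UnbSub B l
  · exact h B hBA hB
  · have hdiff : UnbSub (A \ B) l := by
      refine ⟨sdiff_subset.trans hA.1, fun b hb => ?_⟩
      have hB' : ∃ c < l, ∀ a ∈ B, a < c := by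
        by_contra! hcon
        exact hB ⟨hBA.trans hA.1, hcon⟩
      obtain ⟨c, hc, hcB⟩ := hB'
      obtain ⟨a, ha, hba⟩ := hA.2 (max b c) (max_lt hb hc)
      exact ⟨a, ⟨ha, fun haB => ((le_max_right b c).trans hba).not_gt (hcB a haB)⟩,
        (le_max_left b c).trans hba⟩
    have := (h A subset_rfl hA).diff (h _ sdiff_subset hdiff)
    rwa [sdiff_sdiff_right_self, inter_eq_right.2 hBA] at this

theorem exists_fresh_of_cof_eq (hU : IsNormalUltrafilter δ U)
    (hGCH : (2 : Cardinal.{0}) ^ δ = Order.succ δ) {l : Ordinal.{0}}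
    (hcof : l.cof = Order.succ δ) : ∃ A : Set Ordinal.{0}, UnbSub A l ∧ Fresh hU A := by
  obtain ⟨A, hA, hAcard, hAlt⟩ := exists_unbSub_mk_inter_Iio_le hcof
  by_contra! hcon
  have hall : ∀ C ⊆ A, UnbSub C l → InUlt hU C := by
    intro C hCA hC
    by_contra hCn
    refine hcon C hC ⟨hCn, fun α hα => inUlt_of_mk_le hU ?_⟩
    exact (mk_le_mk_of_subset (inter_subset_inter_left _ hCA)).trans
      (hAlt α (hα.trans_le hC.lub_le))
  obtain ⟨F, -, rfl⟩ := hall A subset_rfl hA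
  have hle := mk_inUlt_subsets_le hU (eventually_mk_le hU fun a ha => hAlt a (hA.1 ha))
  have hpow : 𝒫 (ultSet hU F) ⊆ {B | B ⊆ ultSet hU F ∧ InUlt hU B} := fun B hB =>
    ⟨hB, inUlt_of_subset_of_forall_unbSub hU hA hB hall⟩
  have h := (mk_le_mk_of_subset hpow).trans hle
  rw [mk_powerset, hAcard, ← lift_two_power, ← lift_two_power, Cardinal.lift_le, hGCH] at h
  exact (cantor _).not_ge h

/-- Assume `2^δ = δ⁺` and that `Ult(V,U)` has the `δ⁺⁺`-approximation property.
Then for every limit ordinal `λ`, there is an unbounded subset of `λ` that is fresh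
over `Ult(V,U)` if and only if `cof(λ) = δ⁺`. -/
theorem stmt7 (δ : Cardinal.{0}) (U : Ultrafilter (Idx δ)) (hU : IsNormalUltrafilter δ U)
    (hGCH : (2 : Cardinal.{0}) ^ δ = Order.succ δ)
    (happrox : ∀ X : Set Ordinal.{0}, BddAbove X →
      (∀ f : Idx δ → Set Ordinal.{0}, (∀ i, BddAbove (f i)) →
        ordRank hU (fun i => setCardOrd (f i)) < (Order.succ (Order.succ δ)).ord →
        InUlt hU (X ∩ ultSet hU f)) →
      InUlt hU X)
    (l : Ordinal.{0}) (hl : Order.IsSuccLimit l) :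
    (∃ A : Set Ordinal.{0}, UnbSub A l ∧ Fresh hU A) ↔ l.cof = Order.succ δ := by
  refine ⟨?_, exists_fresh_of_cof_eq hU hGCH⟩
  rintro ⟨A, hA, hfr⟩
  by_contra hne
  rcases le_or_gt l.cof δ with hle | hlt
  · exact not_fresh_of_cof_le hU hl hle hA hfr
  · have hlt' : Order.succ δ < l.cof := lt_of_le_of_ne (Order.succ_le_of_lt hlt) (Ne.symm hne)
    refine hfr.1 (happrox A ⟨l, fun a ha => (hA.1 ha).le⟩ fun f hf hf' => ?_)
    refine inUlt_inter_ultSet hU hA hfr.2 hf ((mk_ultSet_le hU hf).trans_lt ?_)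
    rw [Cardinal.lift_lt]
    exact (lt_ord.1 hf').trans_le (Order.succ_le_of_lt hlt')

end MU
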